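/- arXiv:2601.14067 — 5 statements merged into one kernel-verified Lean document; each statement's English description precedes it below -/
import Mathlib

section
/- Let t > 0 and let f : ℝ² → ℝ be a bounded continuous function satisfying f(x) = ∫_{ℝ²} (π t)⁻¹ · exp(-‖x - y‖²/t) · f(y) dy for every x ∈ ℝ². Then f is differentiable at every point, and both partial derivatives satisfy the bound |∂₁ f(x)| ≤ 2 · (sup_{y} |f(y)|) / √(π t) and |∂₂ f(x)| ≤ 2 · (sup_{y} |f(y)|) / √(π t) for every x ∈ ℝ². Moreover the partial derivatives are given by differentiating under the integral: ∂ᵢ f(x) = ∫_{ℝ²} ∂ᵢ[(π t)⁻¹ exp(-‖x - y‖²/t)] · f(y) dy. -/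
open MeasureTheory Real

section GaussianKernel

variable {E : Type*} [NormedAddCommGroup E] [InnerProductSpace ℝ E]

/-- The derivative in `x` of the unnormalised Gaussian kernel `exp (-‖x - y‖² / t)`, multiplied
by the constant `c`. -/
lemma hasFDerivAt_const_mul_exp_neg_norm_sub_sq_div (c t : ℝ) (x y : E) :
    HasFDerivAt (fun u : E => c * exp (-‖u - y‖ ^ 2 / t))
      ((c * exp (-‖x - y‖ ^ 2 / t) * (-2 / t)) • innerSL ℝ (x - y)) x := by
  have h := ((((hasFDerivAt_id x).sub_const y).norm_sq.neg.mul_const t⁻¹).exp).const_mul c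
  convert! h using 1
  ext v
  simp [div_eq_mul_inv]
  ring

lemma norm_const_mul_exp_smul_innerSL_le {t : ℝ} (ht : 0 < t) (c : ℝ) {x₀ x : E}
    (hx : ‖x - x₀‖ ≤ 1) (y : E) :
    ‖(c * exp (-‖x - y‖ ^ 2 / t) * (-2 / t)) • innerSL ℝ (x - y)‖ ≤
      |c| * (2 / t) * ((1 + 2 * t) * exp (1 / (2 * t))) *
        exp (-(1 / (4 * t)) * ‖x₀ - y‖ ^ 2) := by
  have htri : ‖x₀ - y‖ ≤ ‖x - y‖ + 1 := by
    have := norm_sub_le_norm_sub_add_norm_sub x₀ x y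
    rw [norm_sub_rev x₀ x] at this
    linarith
  set r := ‖x - y‖
  set s := ‖x₀ - y‖
  have hr : 0 ≤ r := norm_nonneg _
  have hs : 0 ≤ s := norm_nonneg _
  have hrs : s ^ 2 ≤ 2 * r ^ 2 + 2 := by nlinarith [sq_nonneg (r - 1)]
  have hlin : r ≤ (1 + 2 * t) * exp (r ^ 2 / (2 * t)) := by
    have h1 : r ^ 2 / (2 * t) + 1 ≤ exp (r ^ 2 / (2 * t)) := add_one_le_exp _
    have h2 : 2 * t * (r ^ 2 / (2 * t)) = r ^ 2 := by field_simp
    have h3 : 0 ≤ r ^ 2 / (2 * t) := by positivity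
    nlinarith [sq_nonneg (r - 1), mul_le_mul_of_nonneg_left h1 (by positivity : 0 ≤ 1 + 2 * t)]
  have hexp : r * exp (-r ^ 2 / t) ≤
      (1 + 2 * t) * exp (1 / (2 * t)) * exp (-(1 / (4 * t)) * s ^ 2) := by
    calc r * exp (-r ^ 2 / t)
        ≤ (1 + 2 * t) * exp (r ^ 2 / (2 * t)) * exp (-r ^ 2 / t) := by gcongr
      _ = (1 + 2 * t) * exp (-(1 / (4 * t)) * (2 * r ^ 2)) := by
          rw [mul_assoc, ← exp_add]; congr 2; field_simp; ring
      _ ≤ (1 + 2 * t) * exp (1 / (2 * t) + -(1 / (4 * t)) * s ^ 2) := by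
          gcongr
          have : 1 / (2 * t) = 1 / (4 * t) * 2 := by field_simp; norm_num
          rw [this]
          nlinarith [mul_le_mul_of_nonneg_left hrs (by positivity : 0 ≤ 1 / (4 * t))]
      _ = _ := by rw [exp_add, mul_assoc]
  rw [norm_smul, innerSL_apply_norm, norm_mul, norm_mul, norm_eq_abs, norm_eq_abs, abs_exp,
    norm_div, norm_neg, Real.norm_of_nonneg ht.le, Real.norm_ofNat]
  calc |c| * exp (-r ^ 2 / t) * (2 / t) * r = |c| * (2 / t) * (r * exp (-r ^ 2 / t)) := by ring
    _ ≤ |c| * (2 / t) *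
          ((1 + 2 * t) * exp (1 / (2 * t)) * exp (-(1 / (4 * t)) * s ^ 2)) := by gcongr
    _ = _ := by ring

variable [FiniteDimensional ℝ E] [MeasurableSpace E] [BorelSpace E]

lemma integrable_exp_neg_mul_norm_sub_sq {b : ℝ} (hb : 0 < b) (x : E) :
    Integrable fun y : E => exp (-b * ‖x - y‖ ^ 2) := by
  have h : Integrable fun y : E => exp (-b * ‖y‖ ^ 2) :=
    .of_integral_ne_zero <| by
      rw [GaussianFourier.integral_rexp_neg_mul_sq_norm hb]
      positivity
  exact h.comp_sub_left x

/-- The Gaussian convolution of a bounded continuous function can be differentiated under the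
integral sign. -/
lemma hasFDerivAt_integral_gaussian_mul {t C : ℝ} (ht : 0 < t) (c : ℝ) {f : E → ℝ}
    (hf : Continuous f) (hC : ∀ y, |f y| ≤ C) (x₀ : E) :
    Integrable (fun y => f y • (c * exp (-‖x₀ - y‖ ^ 2 / t) * (-2 / t)) • innerSL ℝ (x₀ - y)) ∧
    HasFDerivAt (fun x => ∫ y, c * exp (-‖x - y‖ ^ 2 / t) * f y)
      (∫ y, f y • (c * exp (-‖x₀ - y‖ ^ 2 / t) * (-2 / t)) • innerSL ℝ (x₀ - y)) x₀ := by
  have hbound : ∀ y, ∀ x ∈ Metric.ball x₀ 1,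
      ‖f y • (c * exp (-‖x - y‖ ^ 2 / t) * (-2 / t)) • innerSL ℝ (x - y)‖ ≤
        C * (|c| * (2 / t) * ((1 + 2 * t) * exp (1 / (2 * t))) *
          exp (-(1 / (4 * t)) * ‖x₀ - y‖ ^ 2)) := by
    intro y x hx
    rw [norm_smul]
    exact mul_le_mul (hC y)
      (norm_const_mul_exp_smul_innerSL_le ht c (mem_ball_iff_norm.1 hx).le y)
      (norm_nonneg _) ((abs_nonneg _).trans (hC y))
  have hint : Integrable fun y => C * (|c| * (2 / t) * ((1 + 2 * t) * exp (1 / (2 * t))) *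
      exp (-(1 / (4 * t)) * ‖x₀ - y‖ ^ 2)) :=
    ((integrable_exp_neg_mul_norm_sub_sq (by positivity) x₀).const_mul _).const_mul _
  have hmeas : AEStronglyMeasurable
      (fun y => f y • (c * exp (-‖x₀ - y‖ ^ 2 / t) * (-2 / t)) • innerSL ℝ (x₀ - y)) :=
    Continuous.aestronglyMeasurable (by fun_prop)
  refine ⟨hint.mono' hmeas (.of_forall fun y => hbound y x₀ (Metric.mem_ball_self one_pos)), ?_⟩
  refine hasFDerivAt_integral_of_dominated_of_fderiv_le (Metric.ball_mem_nhds x₀ one_pos)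
    (.of_forall fun x => Continuous.aestronglyMeasurable (by fun_prop)) ?_ hmeas
    (.of_forall hbound) hint
    (.of_forall fun y x _ =>
      (hasFDerivAt_const_mul_exp_neg_norm_sub_sq_div c t x y).mul_const (f y))
  refine Integrable.mul_bdd (c := C) (Integrable.const_mul ?_ c) hf.aestronglyMeasurable
    (.of_forall hC)
  convert! integrable_exp_neg_mul_norm_sub_sq (inv_pos.2 ht) x₀ using 3
  ring

end GaussianKernel

lemma integral_abs_mul_exp_neg_sq_div {t : ℝ} (ht : 0 < t) :
    ∫ x : ℝ, |x| * exp (-x ^ 2 / t) = t := by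
  have h := integral_comp_abs (f := fun x => x * exp (-x ^ 2 / t))
  simp only [sq_abs] at h
  have h2 := integral_mul_cexp_neg_mul_sq (b := ((t⁻¹ : ℝ) : ℂ)) (by simpa using ht)
  have h3 : ∫ x : ℝ in Set.Ioi 0, x * exp (-x ^ 2 / t) = (2 * t⁻¹)⁻¹ := by
    rw [← Complex.ofReal_inj, ← integral_complex_ofReal]
    push_cast
    push_cast at h2
    rw [← h2]
    congr 1 with x
    congr 2
    ring
  rw [h, h3]
  field_simp

lemma integral_exp_neg_sq_div (t : ℝ) : ∫ x : ℝ, exp (-x ^ 2 / t) = √(π * t) := by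
  rw [← div_inv_eq_mul, ← integral_gaussian]
  congr 1 with x
  congr 1
  ring

lemma integral_abs_apply_mul_exp_neg_norm_sq_div {t : ℝ} (ht : 0 < t) (i : Fin 2) :
    ∫ v : EuclideanSpace ℝ (Fin 2), |v i| * exp (-‖v‖ ^ 2 / t) = t * √(π * t) := by
  rw [← (PiLp.volume_preserving_toLp (Fin 2)).integral_comp
    (MeasurableEquiv.toLp 2 _).measurableEmbedding]
  have h := integral_fintype_prod_volume_eq_prod (ι := Fin 2) (E := fun _ => ℝ) (𝕜 := ℝ)
    (fun j x => (if j = i then |x| else 1) * exp (-x ^ 2 / t))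
  convert! h using 1
  · congr 1 with v
    rw [Finset.prod_mul_distrib, Finset.prod_ite_eq', ← exp_sum, EuclideanSpace.real_norm_sq_eq,
      ← Finset.sum_div, Finset.sum_neg_distrib]
    simp
  · fin_cases i <;>
      simp [Fin.prod_univ_two, integral_abs_mul_exp_neg_sq_div ht, integral_exp_neg_sq_div,
        mul_comm]

open MeasureTheory Real

/-- If a bounded continuous function `f : ℝ² → ℝ` equals its own convolution with the
Gaussian kernel `g_t(u) = (π t)⁻¹ exp(-‖u‖²/t)` (`t > 0`), then `f` is everywhere
differentiable, its partial derivatives are bounded by `2 (sup |f|) / √(π t)`, and they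
are obtained by differentiating under the integral. -/
theorem stmt1 (t : ℝ) (ht : 0 < t) (f : EuclideanSpace ℝ (Fin 2) → ℝ)
    (hcont : Continuous f) (hbdd : ∃ C : ℝ, ∀ x, |f x| ≤ C)
    (hfix : ∀ x : EuclideanSpace ℝ (Fin 2),
      f x = ∫ y : EuclideanSpace ℝ (Fin 2), (π * t)⁻¹ * Real.exp (-‖x - y‖ ^ 2 / t) * f y) :
    (∀ x, DifferentiableAt ℝ f x) ∧
    (∀ (x : EuclideanSpace ℝ (Fin 2)) (i : Fin 2),
      |fderiv ℝ f x (EuclideanSpace.single i 1)| ≤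
        2 * (⨆ y, |f y|) / Real.sqrt (π * t)) ∧
    (∀ (x : EuclideanSpace ℝ (Fin 2)) (i : Fin 2),
      fderiv ℝ f x (EuclideanSpace.single i 1) =
        ∫ y : EuclideanSpace ℝ (Fin 2),
          (fderiv ℝ (fun u : EuclideanSpace ℝ (Fin 2) =>
            (π * t)⁻¹ * Real.exp (-‖u - y‖ ^ 2 / t)) x) (EuclideanSpace.single i 1) * f y) := by
  obtain ⟨C, hC⟩ := hbdd
  have hderiv : ∀ x, HasFDerivAt f (∫ y, f y • ((π * t)⁻¹ * exp (-‖x - y‖ ^ 2 / t) * (-2 / t)) •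
      innerSL ℝ (x - y)) x := fun x => by
    have h := (hasFDerivAt_integral_gaussian_mul ht (π * t)⁻¹ hcont hC x).2
    rwa [← funext hfix] at h
  have hpartial : ∀ (x : EuclideanSpace ℝ (Fin 2)) (i : Fin 2),
      fderiv ℝ f x (EuclideanSpace.single i 1) =
        ∫ y, f y * ((π * t)⁻¹ * exp (-‖x - y‖ ^ 2 / t) * (-2 / t) * (x - y) i) := by
    intro x i
    rw [(hderiv x).fderiv, ContinuousLinearMap.integral_apply
      (hasFDerivAt_integral_gaussian_mul ht (π * t)⁻¹ hcont hC x).1]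
    simp [EuclideanSpace.inner_single_right]
  refine ⟨fun x => (hderiv x).differentiableAt, fun x i => ?_, fun x i => ?_⟩
  · have hsup : ∀ y, |f y| ≤ ⨆ y, |f y| :=
      le_ciSup ⟨C, by rintro _ ⟨y, rfl⟩; exact hC y⟩
    have hmass := integral_abs_apply_mul_exp_neg_norm_sq_div ht i
    have hint : Integrable fun v : EuclideanSpace ℝ (Fin 2) => |v i| * exp (-‖v‖ ^ 2 / t) :=
      .of_integral_ne_zero <| by rw [hmass]; positivity
    rw [hpartial, ← norm_eq_abs]
    calc _ ≤ ∫ y, ((⨆ y, |f y|) * ((π * t)⁻¹ * (2 / t))) *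
            (|(x - y) i| * exp (-‖x - y‖ ^ 2 / t)) := by
          refine norm_integral_le_of_norm_le ((hint.comp_sub_left x).const_mul _)
            (.of_forall fun y => ?_)
          rw [norm_mul, norm_mul, norm_mul, norm_mul, norm_eq_abs, norm_eq_abs,
            norm_eq_abs, norm_eq_abs, norm_eq_abs, abs_exp, abs_div, abs_neg, abs_two,
            abs_of_pos ht, abs_of_pos (by positivity : 0 < (π * t)⁻¹)]
          calc _ = |f y| * ((π * t)⁻¹ * (2 / t) * (|(x - y) i| * exp (-‖x - y‖ ^ 2 / t))) := by
                ring
            _ ≤ (⨆ y, |f y|) * _ := mul_le_mul_of_nonneg_right (hsup y) (by positivity)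
            _ = _ := by ring
      _ = ((⨆ y, |f y|) * ((π * t)⁻¹ * (2 / t))) * (t * √(π * t)) := by
          rw [integral_const_mul, ← hmass]
          congr 1
          exact integral_sub_left_eq_self
            (fun v : EuclideanSpace ℝ (Fin 2) => |v i| * exp (-‖v‖ ^ 2 / t)) volume x
      _ = _ := by
          have hsq : √(π * t) ^ 2 = π * t := sq_sqrt (by positivity)
          have hpos : 0 < √(π * t) := by positivity
          generalize √(π * t) = s at hsq hpos ⊢
          rw [← hsq]
          field_simp
  · rw [hpartial]
    congr 1 with y
    rw [(hasFDerivAt_const_mul_exp_neg_norm_sub_sq_div _ t x y).fderiv]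
    simp [EuclideanSpace.inner_single_right]
    ring
end

section
/- Let H be a separable infinite-dimensional complex Hilbert space with a Hilbert (orthonormal) basis (e_n)_{n ∈ ℕ}, and for z ∈ ℂ let c(z) be the coherent vector. Suppose T ∈ B(H) is a bounded operator such that for all φ, ψ ∈ H, ⟪φ, T ψ⟫ = π⁻¹ ∫_ℂ ⟪c(z), T (c(z))⟫ · ⟪φ, c(z)⟫ · ⟪c(z), ψ⟫ dz, the integral taken with respect to Lebesgue measure on ℂ ≅ ℝ². Then there exists λ ∈ ℂ such that T = λ · 1. In other words, the only fixed points of the 'Husimi Q-function' entanglement-breaking channel T ↦ π⁻¹ ∫_ℂ |c(z)⟩⟨c(z)| · ⟪c(z), T c(z)⟫ dz are the scalar multiples of the identity. -/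
open MeasureTheory Real
open scoped ComplexInnerProductSpace

/-- The coherent vector `c(z) = exp(-|z|²/2) Σₙ (zⁿ/√(n!)) eₙ` associated with a
Hilbert basis `(eₙ)` of a separable complex Hilbert space. -/
noncomputable def coherent {H : Type*} [NormedAddCommGroup H] [InnerProductSpace ℂ H]
    [CompleteSpace H] (e : HilbertBasis ℕ ℂ H) (z : ℂ) : H :=
  Complex.exp (-(‖z‖ : ℂ) ^ 2 / 2) • ∑' n : ℕ, (z ^ n / (Real.sqrt n.factorial : ℂ)) • e n

theorem integrable_gaussian {b : ℝ} (hb : 0 < b) (w : ℂ) :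
    Integrable fun z : ℂ => rexp (-b * ‖z - w‖ ^ 2) := by
  have h := (GaussianFourier.integrable_cexp_neg_mul_sq_norm_add (V := ℂ) (b := b)
    (by simpa using hb) 0 0).norm
  refine Integrable.comp_sub_right (f := fun z : ℂ => rexp (-b * ‖z‖ ^ 2)) (h.congr ?_) w
  filter_upwards with z
  rw [Complex.norm_exp]
  simp [← Complex.ofReal_pow]

theorem integral_gaussian_sub {b : ℝ} (hb : 0 < b) (w : ℂ) :
    ∫ z : ℂ, rexp (-b * ‖z - w‖ ^ 2) = π / b := by
  rw [integral_sub_right_eq_self (fun z : ℂ => rexp (-b * ‖z‖ ^ 2)) w,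
    GaussianFourier.integral_rexp_neg_mul_sq_norm hb]
  simp [Complex.finrank_real_complex]

theorem integral_gaussian_mul_gaussian {b : ℝ} (hb : 0 < b) (y w : ℂ) :
    ∫ z : ℂ, rexp (-b * ‖y - z‖ ^ 2) * rexp (-b * ‖z - w‖ ^ 2) =
      π / (2 * b) * rexp (-(b / 2) * ‖y - w‖ ^ 2) := by
  have key : ∀ z : ℂ, rexp (-b * ‖y - z‖ ^ 2) * rexp (-b * ‖z - w‖ ^ 2) =
      rexp (-(2 * b) * ‖z - (y + w) / 2‖ ^ 2) * rexp (-(b / 2) * ‖y - w‖ ^ 2) := by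
    intro z
    rw [← Real.exp_add, ← Real.exp_add]
    congr 1
    simp only [← Complex.normSq_eq_norm_sq, Complex.normSq_apply, Complex.sub_re, Complex.sub_im,
      Complex.add_re, Complex.add_im, Complex.div_ofNat_re, Complex.div_ofNat_im]
    ring
  simp_rw [key]
  rw [integral_mul_const, integral_gaussian_sub (by positivity)]

theorem gaussian_average_half {f : ℂ → ℂ} (hf : Continuous f) {C : ℝ} (hC : ∀ z, ‖f z‖ ≤ C)
    {b : ℝ} (hb : 0 < b)
    (h : ∀ w, f w = (b / π : ℝ) * ∫ z, f z * (rexp (-b * ‖z - w‖ ^ 2) : ℝ)) (w : ℂ) :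
    f w = (b / 2 / π : ℝ) * ∫ z, f z * (rexp (-(b / 2) * ‖z - w‖ ^ 2) : ℝ) := by
  have hint : Integrable (Function.uncurry fun z y : ℂ =>
      f y * (rexp (-b * ‖y - z‖ ^ 2) * rexp (-b * ‖z - w‖ ^ 2) : ℝ)) (volume.prod volume) := by
    have hg := ((integrable_gaussian (b := b / 4) (by positivity) w).mul_prod
      (integrable_gaussian (b := b / 4) (by positivity) w)).const_mul C
    refine hg.mono' ?_ ?_
    · apply Continuous.aestronglyMeasurable
      unfold Function.uncurry
      fun_prop
    · filter_upwards with p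
      obtain ⟨z, y⟩ := p
      simp only [Function.uncurry, norm_mul, Complex.norm_real, Real.norm_eq_abs, Real.abs_exp]
      refine mul_le_mul (hC y) ?_ (by positivity) ((norm_nonneg _).trans (hC y))
      rw [← Real.exp_add, ← Real.exp_add, Real.exp_le_exp]
      have h1 : ‖y - w‖ ^ 2 ≤ (‖y - z‖ + ‖z - w‖) ^ 2 := by
        gcongr
        exact norm_sub_le_norm_sub_add_norm_sub y z w
      have h2 : ‖z - w‖ ^ 2 + ‖y - w‖ ^ 2 ≤ 4 * (‖y - z‖ ^ 2 + ‖z - w‖ ^ 2) := by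
        nlinarith [sq_nonneg (‖y - z‖ - ‖z - w‖), sq_nonneg ‖y - z‖, sq_nonneg ‖z - w‖]
      nlinarith
  have hswap := integral_integral_swap hint
  have hinner : ∀ z : ℂ, (b / π : ℝ) * ∫ y : ℂ,
      f y * (rexp (-b * ‖y - z‖ ^ 2) * rexp (-b * ‖z - w‖ ^ 2) : ℝ) =
      f z * (rexp (-b * ‖z - w‖ ^ 2) : ℝ) := by
    intro z
    conv_rhs => rw [h z, mul_assoc, ← integral_mul_const]
    simp only [Complex.ofReal_mul, mul_assoc]
  rw [h w]
  simp_rw [← hinner]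
  rw [integral_const_mul, hswap]
  simp_rw [integral_const_mul, integral_complex_ofReal, integral_gaussian_mul_gaussian hb,
    Complex.ofReal_mul (π / (2 * b)), mul_left_comm _ ((π / (2 * b) : ℝ) : ℂ)]
  rw [integral_const_mul, ← mul_assoc, ← mul_assoc]
  congr 1
  norm_cast
  field_simp

theorem tendsto_integral_gaussian_sub :
    Filter.Tendsto (fun a : ℂ => ∫ z : ℂ, |rexp (-‖z - a‖ ^ 2) - rexp (-‖z‖ ^ 2)|)
      (nhds 0) (nhds 0) := by
  have hb : Integrable fun z : ℂ =>
      rexp 1 * rexp (-(1 / 2) * ‖z - 0‖ ^ 2) + rexp (-1 * ‖z - 0‖ ^ 2) :=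
    ((integrable_gaussian (by norm_num) 0).const_mul _).add (integrable_gaussian (by norm_num) 0)
  have := tendsto_integral_filter_of_dominated_convergence (μ := (volume : Measure ℂ))
    (F := fun (a z : ℂ) => |rexp (-‖z - a‖ ^ 2) - rexp (-‖z‖ ^ 2)|) (f := fun _ => 0)
    (l := nhds 0) _ (Filter.Eventually.of_forall fun a => by
      apply Continuous.aestronglyMeasurable; fun_prop) ?_ hb ?_
  · simpa using this
  · filter_upwards [Metric.ball_mem_nhds (0 : ℂ) one_pos] with a ha
    filter_upwards with z
    have ha' : ‖a‖ < 1 := by simpa using ha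
    rw [Real.norm_eq_abs, abs_abs]
    refine (abs_sub _ _).trans ?_
    rw [Real.abs_exp, Real.abs_exp, ← Real.exp_add, sub_zero, neg_one_mul]
    gcongr
    have h1 : ‖z‖ ≤ ‖z - a‖ + ‖a‖ := by simpa using norm_add_le (z - a) a
    have h2 : ‖z‖ ^ 2 ≤ (‖z - a‖ + ‖a‖) ^ 2 := by gcongr
    nlinarith [sq_nonneg (‖z - a‖ - ‖a‖), norm_nonneg a]
  · filter_upwards with z
    have : Continuous fun a : ℂ => |rexp (-‖z - a‖ ^ 2) - rexp (-‖z‖ ^ 2)| := by fun_prop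
    simpa using this.tendsto 0

theorem integral_gaussian_sub_scaled {s : ℝ} (hs : 0 < s) (w : ℂ) :
    ∫ z : ℂ, |rexp (-s ^ 2 * ‖z - w‖ ^ 2) - rexp (-s ^ 2 * ‖z‖ ^ 2)| =
      (s ^ 2)⁻¹ * ∫ z : ℂ, |rexp (-‖z - s • w‖ ^ 2) - rexp (-‖z‖ ^ 2)| := by
  have h := Measure.integral_comp_smul (volume : Measure ℂ)
    (fun z : ℂ => |rexp (-‖z - s • w‖ ^ 2) - rexp (-‖z‖ ^ 2)|) s
  rw [Complex.finrank_real_complex, abs_of_pos (by positivity), smul_eq_mul] at h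
  rw [← h]
  congr 1 with z
  rw [← smul_sub, norm_smul, norm_smul, Real.norm_of_nonneg hs.le]
  ring_nf

theorem eq_of_gaussian_average {f : ℂ → ℂ} (hf : Continuous f) {C : ℝ} (hC : ∀ z, ‖f z‖ ≤ C)
    (h : ∀ w, f w = (π⁻¹ : ℝ) * ∫ z, f z * (rexp (-‖z - w‖ ^ 2) : ℝ)) (w : ℂ) :
    f w = f 0 := by
  have hC0 : 0 ≤ C := (norm_nonneg _).trans (hC 0)
  have hall : ∀ n : ℕ, ∀ w, f w = ((1 / 2) ^ n / π : ℝ) *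
      ∫ z, f z * (rexp (-(1 / 2) ^ n * ‖z - w‖ ^ 2) : ℝ) := by
    intro n
    induction n with
    | zero => simpa [neg_one_mul, one_div] using h
    | succ n ih =>
      have := gaussian_average_half hf hC (by positivity) ih
      simpa only [pow_succ, mul_one_div] using this
  have hbound : ∀ n : ℕ, ‖f w - f 0‖ ≤ C / π *
      ∫ z : ℂ, |rexp (-‖z - √((1 / 2) ^ n) • w‖ ^ 2) - rexp (-‖z‖ ^ 2)| := by
    intro n
    set b : ℝ := (1 / 2) ^ n with hb
    have hbpos : 0 < b := by positivity
    have hi : ∀ v : ℂ, Integrable fun z : ℂ => (rexp (-b * ‖z - v‖ ^ 2) : ℂ) := fun v =>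
      (integrable_gaussian hbpos v).ofReal
    have hfi : ∀ v : ℂ, Integrable fun z : ℂ => f z * (rexp (-b * ‖z - v‖ ^ 2) : ℝ) := fun v =>
      (hi v).bdd_mul hf.aestronglyMeasurable (Filter.Eventually.of_forall hC)
    have hscale := integral_gaussian_sub_scaled (Real.sqrt_pos.2 hbpos) w
    rw [Real.sq_sqrt hbpos.le] at hscale
    rw [hall n w, hall n 0, ← mul_sub, ← integral_sub (hfi w) (hfi 0), norm_mul,
      Complex.norm_real, Real.norm_of_nonneg (by positivity)]
    calc _ ≤ b / π * ∫ z : ℂ, C * |rexp (-b * ‖z - w‖ ^ 2) - rexp (-b * ‖z‖ ^ 2)| := by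
          gcongr
          refine norm_integral_le_of_norm_le ?_ ?_
          · have := ((integrable_gaussian hbpos w).sub (integrable_gaussian hbpos 0)).abs
            simpa using this.const_mul C
          · filter_upwards with z
            rw [← mul_sub, norm_mul, ← Complex.ofReal_sub, Complex.norm_real, Real.norm_eq_abs,
              sub_zero]
            gcongr
            exact hC z
      _ = _ := by
          rw [integral_const_mul, hscale]
          field_simp
  have hs : Filter.Tendsto (fun n : ℕ => √((1 / 2 : ℝ) ^ n) • w) Filter.atTop (nhds 0) := by
    have := ((tendsto_pow_atTop_nhds_zero_of_lt_one (r := (1 / 2 : ℝ)) (by norm_num)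
      (by norm_num)).sqrt).smul_const w
    simpa using this
  have hlim := (tendsto_integral_gaussian_sub.comp hs).const_mul (C / π)
  rw [mul_zero] at hlim
  have := ge_of_tendsto' hlim hbound
  exact sub_eq_zero.1 (norm_le_zero_iff.1 this)

theorem integral_pow_mul_conj_pow_gaussian (m n : ℕ) :
    ∫ z : ℂ, (rexp (-‖z‖ ^ 2) : ℂ) * z ^ m * (starRingEnd ℂ z) ^ n =
      if m = n then (π : ℂ) * n.factorial else 0 := by
  split_ifs with h
  · subst h
    have hG := Complex.integral_rpow_mul_exp_neg_rpow (p := 2) (q := (2 * m : ℕ)) (by norm_num)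
      (by linarith [Nat.cast_nonneg (α := ℝ) (2 * m)])
    have hΓ : (((2 * m : ℕ) : ℝ) + 2) / 2 = m + 1 := by push_cast; ring
    rw [hΓ, Real.Gamma_nat_eq_factorial] at hG
    have hfun : ∀ z : ℂ, (rexp (-‖z‖ ^ 2) : ℂ) * z ^ m * (starRingEnd ℂ z) ^ m =
        ((‖z‖ ^ ((2 * m : ℕ) : ℝ) * rexp (-‖z‖ ^ (2 : ℝ)) : ℝ) : ℂ) := by
      intro z
      rw [mul_assoc, ← mul_pow, Complex.mul_conj, Complex.normSq_eq_norm_sq, Real.rpow_natCast,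
        Real.rpow_two, pow_mul]
      push_cast
      ring
    simp_rw [hfun]
    rw [integral_complex_ofReal, hG]
    push_cast
    ring
  · have hd : (m : ℝ) - n ≠ 0 := sub_ne_zero.2 (by exact_mod_cast h)
    set a : Circle := Circle.exp (π / (m - n)) with ha
    have hrot : (a : ℂ) ^ m * (starRingEnd ℂ (a : ℂ)) ^ n = -1 := by
      have hd' : (m : ℂ) - n ≠ 0 := by exact_mod_cast hd
      rw [ha, Circle.coe_exp, ← Complex.exp_conj, ← Complex.exp_nat_mul, ← Complex.exp_nat_mul,
        ← Complex.exp_add, ← Complex.exp_pi_mul_I]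
      congr 1
      simp only [map_mul, Complex.conj_ofReal, Complex.conj_I]
      push_cast
      field_simp
      ring
    have hinv := ((rotation a).measurePreserving).integral_comp
      (rotation a).toHomeomorph.measurableEmbedding
      (fun z : ℂ => (rexp (-‖z‖ ^ 2) : ℂ) * z ^ m * (starRingEnd ℂ z) ^ n)
    have hfun : ∀ z : ℂ, (rexp (-‖rotation a z‖ ^ 2) : ℂ) * (rotation a z) ^ m *
        (starRingEnd ℂ (rotation a z)) ^ n =
        -((rexp (-‖z‖ ^ 2) : ℂ) * z ^ m * (starRingEnd ℂ z) ^ n) := by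
      intro z
      rw [LinearIsometryEquiv.norm_map, rotation_apply, map_mul, mul_pow, mul_pow]
      linear_combination ((rexp (-‖z‖ ^ 2) : ℂ) * z ^ m * (starRingEnd ℂ z) ^ n) * hrot
    simp_rw [hfun, integral_neg] at hinv
    exact self_eq_neg.1 hinv.symm

section Coherent

variable {H : Type*} [NormedAddCommGroup H] [InnerProductSpace ℂ H] [CompleteSpace H]
  (e : HilbertBasis ℕ ℂ H)

theorem memℓp_coherent_coeff (z : ℂ) :
    Memℓp (fun n : ℕ => z ^ n / (√n.factorial : ℂ)) 2 := by
  refine memℓp_gen ?_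
  convert Real.summable_pow_div_factorial (‖z‖ ^ 2) using 2 with n
  rw [norm_div, norm_pow, Complex.norm_real, Real.norm_of_nonneg (Real.sqrt_nonneg _)]
  simp only [ENNReal.toReal_ofNat, Real.rpow_two]
  rw [div_pow, Real.sq_sqrt (by positivity), pow_right_comm]

theorem inner_basis_coherent (n : ℕ) (z : ℂ) :
    ⟪e n, coherent e z⟫ = rexp (-‖z‖ ^ 2 / 2) * (z ^ n / (√n.factorial : ℂ)) := by
  have h := (e.hasSum_repr_symm ⟨_, memℓp_coherent_coeff z⟩).tsum_eq
  rw [coherent, inner_smul_right, h, ← e.repr_apply_apply, LinearIsometryEquiv.apply_symm_apply]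
  simp

theorem inner_coherent_basis (n : ℕ) (z : ℂ) :
    ⟪coherent e z, e n⟫ =
      rexp (-‖z‖ ^ 2 / 2) * ((starRingEnd ℂ z) ^ n / (√n.factorial : ℂ)) := by
  rw [← inner_conj_symm, inner_basis_coherent]
  simp only [map_mul, map_div₀, map_pow, Complex.conj_ofReal]

theorem inner_coherent_coherent (w z : ℂ) :
    ⟪coherent e w, coherent e z⟫ =
      rexp (-‖w‖ ^ 2 / 2) * rexp (-‖z‖ ^ 2 / 2) * Complex.exp (starRingEnd ℂ w * z) := by
  have h := NormedSpace.expSeries_div_hasSum_exp (starRingEnd ℂ w * z)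
  rw [← Complex.exp_eq_exp_ℂ] at h
  refine (e.hasSum_inner_mul_inner (coherent e w) (coherent e z)).unique ?_
  refine (h.mul_left ((rexp (-‖w‖ ^ 2 / 2) : ℂ) * rexp (-‖z‖ ^ 2 / 2))).congr_fun fun n => ?_
  rw [inner_coherent_basis, inner_basis_coherent, mul_mul_mul_comm, div_mul_div_comm, mul_pow,
    ← Complex.ofReal_mul (√_), Real.mul_self_sqrt (by positivity), Complex.ofReal_natCast]

theorem inner_coherent_self (z : ℂ) : ⟪coherent e z, coherent e z⟫ = 1 := by
  rw [inner_coherent_coherent, mul_comm (starRingEnd ℂ z), Complex.mul_conj,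
    Complex.normSq_eq_norm_sq]
  norm_cast
  rw [← Real.exp_add, ← Real.exp_add]
  ring_nf
  simp

theorem norm_coherent (z : ℂ) : ‖coherent e z‖ = 1 := by
  rw [@norm_eq_sqrt_re_inner ℂ, inner_coherent_self]
  simp

theorem inner_coherent_mul_inner_coherent (w z : ℂ) :
    ⟪coherent e w, coherent e z⟫ * ⟪coherent e z, coherent e w⟫ = (rexp (-‖z - w‖ ^ 2) : ℝ) := by
  rw [inner_coherent_coherent, inner_coherent_coherent, Complex.ofReal_exp]
  simp only [Complex.ofReal_exp, ← Complex.exp_add]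
  congr 1
  have key : ((‖z - w‖ ^ 2 : ℝ) : ℂ) = ‖z‖ ^ 2 + ‖w‖ ^ 2 - starRingEnd ℂ w * z -
      starRingEnd ℂ z * w := by
    rw [← Complex.ofReal_pow, ← Complex.ofReal_pow, ← Complex.normSq_eq_norm_sq,
      ← Complex.normSq_eq_norm_sq, ← Complex.normSq_eq_norm_sq, ← Complex.mul_conj,
      ← Complex.mul_conj, ← Complex.mul_conj, map_sub]
    ring
  rw [Complex.ofReal_neg, key]
  push_cast
  ring

theorem continuous_coherent : Continuous (coherent e) := by
  rw [continuous_iff_continuousAt]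
  intro w
  have hinner : Continuous fun z : ℂ => ⟪coherent e w, coherent e z⟫ := by
    simp_rw [inner_coherent_coherent]
    fun_prop
  have hsq : ∀ z, ‖coherent e z - coherent e w‖ ^ 2 =
      2 - 2 * (⟪coherent e w, coherent e z⟫).re := by
    intro z
    rw [norm_sub_rev, @norm_sub_sq ℂ, norm_coherent, norm_coherent, RCLike.re_eq_complex_re]
    ring
  have hlim : Filter.Tendsto (fun z => √(2 - 2 * (⟪coherent e w, coherent e z⟫).re))
      (nhds w) (nhds 0) := by
    have : Continuous fun z => √(2 - 2 * (⟪coherent e w, coherent e z⟫).re) := by fun_prop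
    convert this.tendsto w using 2
    simp only [inner_coherent_self, Complex.one_re, mul_one, sub_self, Real.sqrt_zero]
  refine tendsto_iff_norm_sub_tendsto_zero.2 (hlim.congr fun z => ?_)
  rw [← hsq, Real.sqrt_sq (norm_nonneg _)]

theorem integral_inner_coherent_basis (m n : ℕ) :
    ∫ z : ℂ, ⟪e m, coherent e z⟫ * ⟪coherent e z, e n⟫ = if m = n then (π : ℂ) else 0 := by
  have hfun : ∀ z : ℂ, ⟪e m, coherent e z⟫ * ⟪coherent e z, e n⟫ =
      ((√m.factorial : ℂ) * (√n.factorial : ℂ))⁻¹ *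
        ((rexp (-‖z‖ ^ 2) : ℂ) * z ^ m * (starRingEnd ℂ z) ^ n) := by
    intro z
    have hexp : rexp (-‖z‖ ^ 2) = rexp (-‖z‖ ^ 2 / 2) * rexp (-‖z‖ ^ 2 / 2) := by
      rw [← Real.exp_add]
      ring_nf
    rw [inner_basis_coherent, inner_coherent_basis, hexp, Complex.ofReal_mul]
    ring
  simp_rw [hfun]
  rw [integral_const_mul, integral_pow_mul_conj_pow_gaussian]
  split_ifs with h
  · subst h
    rw [← Complex.ofReal_mul, Real.mul_self_sqrt (by positivity), Complex.ofReal_natCast]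
    have : (m.factorial : ℂ) ≠ 0 := by exact_mod_cast m.factorial_ne_zero
    field_simp
  · simp

end Coherent

/-- The only fixed points of the Husimi `Q`-function entanglement-breaking channel
`T ↦ π⁻¹ ∫_ℂ |c(z)⟩⟨c(z)| ⟪c(z), T c(z)⟫ dz` are the scalar multiples of the identity. -/
theorem stmt2 {H : Type*} [NormedAddCommGroup H] [InnerProductSpace ℂ H] [CompleteSpace H]
    (e : HilbertBasis ℕ ℂ H) (T : H →L[ℂ] H)
    (hT : ∀ φ ψ : H, ⟪φ, T ψ⟫ = (Real.pi : ℂ)⁻¹ *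
      ∫ z : ℂ, ⟪coherent e z, T (coherent e z)⟫ * ⟪φ, coherent e z⟫ * ⟪coherent e z, ψ⟫) :
    ∃ lam : ℂ, T = lam • (1 : H →L[ℂ] H) := by
  set q : ℂ → ℂ := fun z => ⟪coherent e z, T (coherent e z)⟫ with hq
  have hcont : Continuous q :=
    (continuous_coherent e).inner (T.continuous.comp (continuous_coherent e))
  have hbound : ∀ z, ‖q z‖ ≤ ‖T‖ := fun z => by
    refine (norm_inner_le_norm _ _).trans ?_
    simpa [norm_coherent] using T.le_opNorm (coherent e z)
  have hconst : ∀ z, q z = q 0 := eq_of_gaussian_average hcont hbound fun w => by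
    simp_rw [← inner_coherent_mul_inner_coherent e w, ← mul_assoc]
    rw [Complex.ofReal_inv]
    exact hT _ _
  have hbasis : ∀ m n, ⟪e m, T (e n)⟫ = if m = n then q 0 else 0 := by
    intro m n
    have hqz : ∀ z, ⟪coherent e z, T (coherent e z)⟫ = q 0 := hconst
    rw [hT]
    simp_rw [hqz, mul_assoc]
    rw [integral_const_mul, integral_inner_coherent_basis]
    split_ifs
    · have : (π : ℂ) ≠ 0 := by exact_mod_cast Real.pi_ne_zero
      field_simp
    · simp
  refine ⟨q 0, ContinuousLinearMap.ext_on
    (Submodule.dense_iff_topologicalClosure_eq_top.2 e.dense_span) ?_⟩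
  rintro _ ⟨n, rfl⟩
  refine e.repr.injective (lp.ext (funext fun m => ?_))
  rw [e.repr_apply_apply, e.repr_apply_apply, hbasis, smul_apply,
    one_apply_eq_self, inner_smul_right, orthonormal_iff_ite.1 e.orthonormal]
  simp
end

section
/- Let H be a separable complex Hilbert space with a Hilbert (orthonormal) basis (e_n)_{n ∈ ℕ}, and for z ∈ ℂ let c(z) be the coherent vector. Then for all φ, ψ ∈ H, the function z ↦ ⟪φ, c(z)⟫ · ⟪c(z), ψ⟫ is integrable over ℂ and π⁻¹ ∫_ℂ ⟪φ, c(z)⟫ · ⟪c(z), ψ⟫ dz = ⟪φ, ψ⟫, where the integral is with respect to Lebesgue measure on ℂ ≅ ℝ². (Resolution of the identity for coherent vectors: the family X ↦ π⁻¹ ∫_X |c(z)⟩⟨c(z)| dz defines a normalized positive operator measure.) -/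
open MeasureTheory Real
open scoped ComplexInnerProductSpace

/-- The coefficient of the coherent vector `c(z)` at `eₙ`. -/
noncomputable def coherentCoeff (n : ℕ) (z : ℂ) : ℂ :=
  Complex.exp (-(‖z‖ : ℂ) ^ 2 / 2) * (z ^ n / (Real.sqrt n.factorial : ℂ))

lemma continuous_coherentCoeff (n : ℕ) : Continuous (coherentCoeff n) := by
  unfold coherentCoeff
  fun_prop

lemma norm_coherentCoeff_sq (n : ℕ) (z : ℂ) :
    ‖coherentCoeff n z‖ ^ 2 = (n.factorial : ℝ)⁻¹ * (‖z‖ ^ (2 * n : ℝ) * rexp (-‖z‖ ^ (2 : ℝ))) := by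
  have h1 : ‖Complex.exp (-(‖z‖ : ℂ) ^ 2 / 2)‖ = rexp (-‖z‖ ^ 2 / 2) := by
    rw [Complex.norm_exp]
    congr 1
    rw [show (-(‖z‖ : ℂ) ^ 2 / 2) = ((-‖z‖ ^ 2 / 2 : ℝ) : ℂ) by push_cast; ring]
    exact Complex.ofReal_re _
  have h2 : rexp (-‖z‖ ^ 2 / 2) ^ 2 = rexp (-‖z‖ ^ (2 : ℝ)) := by
    rw [← Real.exp_nat_mul, Real.rpow_two]
    congr 1
    push_cast
    ring
  have h3 : ‖z‖ ^ (2 * n : ℝ) = (‖z‖ ^ n) ^ 2 := by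
    rw [show (2 * n : ℝ) = ((n * 2 : ℕ) : ℝ) by push_cast; ring, Real.rpow_natCast, pow_mul]
  rw [coherentCoeff, norm_mul, norm_div, norm_pow, h1, Complex.norm_real, Real.norm_eq_abs,
    abs_of_nonneg (Real.sqrt_nonneg _), mul_pow, div_pow, Real.sq_sqrt (by positivity), h2, h3]
  ring

lemma integral_norm_coherentCoeff_sq (n : ℕ) : ∫ z : ℂ, ‖coherentCoeff n z‖ ^ 2 = π := by
  simp_rw [norm_coherentCoeff_sq]
  have hn : (-2 : ℝ) < 2 * n := by linarith [n.cast_nonneg (α := ℝ)]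
  rw [integral_const_mul, Complex.integral_rpow_mul_exp_neg_rpow one_le_two hn,
    show ((2 * n + 2) / 2 : ℝ) = n + 1 by ring, Real.Gamma_nat_eq_factorial]
  field_simp

lemma memLp_coherentCoeff (n : ℕ) : MemLp (coherentCoeff n) 2 := by
  refine (memLp_two_iff_integrable_sq_norm (continuous_coherentCoeff n).aestronglyMeasurable).2 ?_
  apply Integrable.of_integral_ne_zero
  rw [integral_norm_coherentCoeff_sq]
  exact Real.pi_ne_zero

lemma coherentCoeff_circle_mul (n : ℕ) (u : Circle) (z : ℂ) :
    coherentCoeff n (u * z) = (u : ℂ) ^ n * coherentCoeff n z := by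
  simp only [coherentCoeff, norm_mul, Circle.norm_coe, one_mul, mul_pow]
  ring

lemma integral_coherentCoeff_mul_conj_of_ne {n m : ℕ} (h : n ≠ m) :
    ∫ z : ℂ, coherentCoeff n z * starRingEnd ℂ (coherentCoeff m z) = 0 := by
  let u : Circle := Circle.exp (π / (n - m))
  have hu : (u : ℂ) ^ n * starRingEnd ℂ ((u : ℂ) ^ m) = -1 := by
    have hnm : (n - m : ℂ) ≠ 0 := sub_ne_zero.2 (by exact_mod_cast h)
    rw [map_pow, ← Circle.coe_inv_eq_conj, ← Circle.exp_neg, Circle.coe_exp, Circle.coe_exp,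
      ← Complex.exp_nat_mul, ← Complex.exp_nat_mul, ← Complex.exp_add, ← Complex.exp_pi_mul_I]
    congr 1
    push_cast
    field_simp
    ring
  have hrot := (rotation u).measurePreserving.integral_comp
    (rotation u).toHomeomorph.measurableEmbedding
    (fun z : ℂ => coherentCoeff n z * starRingEnd ℂ (coherentCoeff m z))
  have key : ∀ z : ℂ, coherentCoeff n (rotation u z) *
      starRingEnd ℂ (coherentCoeff m (rotation u z)) =
      -(coherentCoeff n z * starRingEnd ℂ (coherentCoeff m z)) := fun z => by
    rw [rotation_apply, coherentCoeff_circle_mul, coherentCoeff_circle_mul, map_mul,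
      mul_mul_mul_comm, hu, neg_one_mul]
  simp_rw [key, integral_neg] at hrot
  exact self_eq_neg.1 hrot.symm

/-- The normalized conjugate coefficient functions, as elements of `L²(ℂ)`. -/
noncomputable def coherentLp (n : ℕ) : Lp ℂ 2 (volume : Measure ℂ) :=
  ((memLp_coherentCoeff n).star.const_mul ((√π : ℂ)⁻¹)).toLp

lemma coeFn_coherentLp (n : ℕ) :
    coherentLp n =ᵐ[volume] fun z => (√π : ℂ)⁻¹ * starRingEnd ℂ (coherentCoeff n z) :=
  MemLp.coeFn_toLp _

lemma ofReal_sqrt_pi_inv_mul_self : (√π : ℂ)⁻¹ * (√π : ℂ)⁻¹ = (π : ℂ)⁻¹ := by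
  rw [← mul_inv, ← Complex.ofReal_mul, Real.mul_self_sqrt Real.pi_nonneg]

lemma orthonormal_coherentLp : Orthonormal ℂ coherentLp := by
  rw [orthonormal_iff_ite]
  intro n m
  have h : ⟪coherentLp n, coherentLp m⟫ = (π : ℂ)⁻¹ *
      ∫ z : ℂ, coherentCoeff n z * starRingEnd ℂ (coherentCoeff m z) := by
    rw [L2.inner_def, ← integral_const_mul]
    refine integral_congr_ae ?_
    filter_upwards [coeFn_coherentLp n, coeFn_coherentLp m] with z hn hm
    rw [hn, hm, ← ofReal_sqrt_pi_inv_mul_self]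
    simp only [RCLike.inner_apply, map_mul, map_inv₀, Complex.conj_ofReal, Complex.conj_conj]
    ring
  rw [h]
  split_ifs with hnm
  · subst hnm
    simp_rw [Complex.mul_conj, Complex.normSq_eq_norm_sq]
    rw [integral_complex_ofReal, integral_norm_coherentCoeff_sq]
    exact inv_mul_cancel₀ (by exact_mod_cast Real.pi_ne_zero)
  · rw [integral_coherentCoeff_mul_conj_of_ne hnm, mul_zero]

section

variable {H : Type*} [NormedAddCommGroup H] [InnerProductSpace ℂ H]

lemma memℓp_pow_div_sqrt_factorial (z : ℂ) :
    Memℓp (fun n : ℕ => z ^ n / (Real.sqrt n.factorial : ℂ)) 2 := by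
  refine memℓp_gen ?_
  refine (Real.summable_pow_div_factorial (‖z‖ ^ 2)).congr fun n => ?_
  rw [ENNReal.toReal_ofNat, Real.rpow_two, norm_div, norm_pow, Complex.norm_real,
    Real.norm_eq_abs, abs_of_nonneg (Real.sqrt_nonneg _), div_pow, Real.sq_sqrt (by positivity),
    ← pow_mul, ← pow_mul, mul_comm]

lemma inner_coherent_basis_s4 [CompleteSpace H] (e : HilbertBasis ℕ ℂ H) (z : ℂ) (n : ℕ) :
    ⟪coherent e z, e n⟫ = starRingEnd ℂ (coherentCoeff n z) := by
  let f : lp (fun _ : ℕ => ℂ) 2 := ⟨_, memℓp_pow_div_sqrt_factorial z⟩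
  have hf : ∑' n : ℕ, (z ^ n / (Real.sqrt n.factorial : ℂ)) • e n = e.repr.symm f :=
    (e.hasSum_repr_symm f).tsum_eq
  rw [coherent, hf, ← inner_conj_symm, inner_smul_right, ← e.repr_apply_apply,
    LinearIsometryEquiv.apply_symm_apply]
  rfl

/-- The coherent state transform `φ ↦ π^(-1/2) ⟪c(·), φ⟫`, as an isometry into `L²(ℂ)`. -/
noncomputable def coherentTransform (e : HilbertBasis ℕ ℂ H) :
    H →ₗᵢ[ℂ] Lp ℂ 2 (volume : Measure ℂ) :=
  orthonormal_coherentLp.orthogonalFamily.linearIsometry.comp e.repr.toLinearIsometry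

lemma coherentTransform_basis (e : HilbertBasis ℕ ℂ H) (n : ℕ) :
    coherentTransform e (e n) = coherentLp n := by
  rw [coherentTransform, LinearIsometry.coe_comp, Function.comp_apply,
    LinearIsometryEquiv.coe_toLinearIsometry, e.repr_self, OrthogonalFamily.linearIsometry_apply_single, LinearIsometry.toSpanSingleton_apply,
    one_smul]

lemma coeFn_coherentTransform [CompleteSpace H] (e : HilbertBasis ℕ ℂ H) (φ : H) :
    coherentTransform e φ =ᵐ[volume] fun z => (√π : ℂ)⁻¹ * ⟪coherent e z, φ⟫ := by
  let S : ℕ → H := fun N => ∑ n ∈ Finset.range N, e.repr φ n • e n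
  have hS : Filter.Tendsto S Filter.atTop (nhds φ) := (e.hasSum_repr φ).tendsto_sum_nat
  have hpartial (N : ℕ) : coherentTransform e (S N) =ᵐ[volume]
      fun z => (√π : ℂ)⁻¹ * ⟪coherent e z, S N⟫ := by
    induction N with
    | zero =>
      simp only [S, Finset.range_zero, Finset.sum_empty, map_zero, inner_zero_right, mul_zero]
      exact Lp.coeFn_zero _ _ _
    | succ N ih =>
      have hsucc : S (N + 1) = S N + e.repr φ N • e N := Finset.sum_range_succ _ _
      rw [hsucc, map_add, map_smul, coherentTransform_basis]
      filter_upwards [ih, coeFn_coherentLp N,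
        Lp.coeFn_add (coherentTransform e (S N)) (e.repr φ N • coherentLp N),
        Lp.coeFn_smul (e.repr φ N) (coherentLp N)] with z h1 h2 h3 h4
      rw [h3, Pi.add_apply, h4, Pi.smul_apply, h1, h2, inner_add_right, inner_smul_right,
        inner_coherent_basis_s4, smul_eq_mul]
      ring
  obtain ⟨ns, hns, hlim⟩ := (tendstoInMeasure_of_tendsto_Lp
    (((coherentTransform e).continuous.tendsto φ).comp hS)).exists_seq_tendsto_ae
  filter_upwards [hlim, ae_all_iff.2 hpartial] with z hz hp
  refine tendsto_nhds_unique hz ?_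
  simp only [Function.comp_apply, hp]
  exact ((tendsto_const_nhds.inner hS).const_mul _).comp hns.tendsto_atTop

end

/-- Resolution of the identity for coherent vectors: for all `φ, ψ` the function
`z ↦ ⟪φ, c(z)⟫⟪c(z), ψ⟫` is integrable over `ℂ` and `π⁻¹ ∫_ℂ ⟪φ, c(z)⟫⟪c(z), ψ⟫ dz = ⟪φ, ψ⟫`. -/
theorem stmt4 {H : Type*} [NormedAddCommGroup H] [InnerProductSpace ℂ H] [CompleteSpace H]
    (e : HilbertBasis ℕ ℂ H) (φ ψ : H) :
    Integrable (fun z : ℂ => ⟪φ, coherent e z⟫ * ⟪coherent e z, ψ⟫) ∧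
    (Real.pi : ℂ)⁻¹ * ∫ z : ℂ, ⟪φ, coherent e z⟫ * ⟪coherent e z, ψ⟫ = ⟪φ, ψ⟫ := by
  have hinner : (fun z => ⟪coherentTransform e φ z, coherentTransform e ψ z⟫) =ᵐ[volume]
      fun z => (π : ℂ)⁻¹ * (⟪φ, coherent e z⟫ * ⟪coherent e z, ψ⟫) := by
    filter_upwards [coeFn_coherentTransform e φ, coeFn_coherentTransform e ψ] with z hφ hψ
    rw [hφ, hψ, ← ofReal_sqrt_pi_inv_mul_self]
    simp only [RCLike.inner_apply, map_mul, map_inv₀, Complex.conj_ofReal, inner_conj_symm]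
    ring
  constructor
  · have hint := (L2.integrable_inner (𝕜 := ℂ)
      (coherentTransform e φ) (coherentTransform e ψ)).congr hinner
    exact (integrable_const_mul_iff
      (isUnit_iff_ne_zero.2 (inv_ne_zero (by exact_mod_cast Real.pi_ne_zero))) _).1 hint
  · rw [← integral_const_mul, ← integral_congr_ae hinner, ← L2.inner_def,
      LinearIsometry.inner_map_map]
end

section
/- Let H be a separable complex Hilbert space and let ω : B(H) → ℂ be a state on B(H). Then the following are equivalent: (1) ω is normal, i.e., there exist nonnegative reals (t_n) with Σ_n t_n = 1 and an orthonormal family (e_n) in H such that ω(A) = Σ_n t_n ⟪e_n, A e_n⟫ for every A ∈ B(H); (2) for every standard Borel measurable space (Ω, 𝒜) and every POVM M : 𝒜 → B(H), the set function X ↦ ω(M(X)) on 𝒜 is countably additive. -/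
open MeasureTheory
open scoped ComplexInnerProductSpace ComplexOrder

/-- A POVM on a measurable space `Ω` with values in `B(H)`: positive operator values,
normalization `M(Ω) = 1`, and weak countable additivity. -/
def IsPOVM {H : Type*} [NormedAddCommGroup H] [InnerProductSpace ℂ H] [CompleteSpace H]
    {Ω : Type*} [MeasurableSpace Ω] (M : Set Ω → (H →L[ℂ] H)) : Prop :=
  (∀ X : Set Ω, MeasurableSet X → (M X).IsPositive) ∧
  M Set.univ = 1 ∧
  ∀ (φ : H) (X : ℕ → Set Ω), (∀ n, MeasurableSet (X n)) →
    (Pairwise fun m n => Disjoint (X m) (X n)) →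
    HasSum (fun n => ⟪φ, M (X n) φ⟫) ⟪φ, M (⋃ n, X n) φ⟫

/-- `ω` is a normal state on `B(H)`: it is given by `ω(A) = Σᵢ tᵢ ⟪eᵢ, A eᵢ⟫` for some
countable family of nonnegative reals `tᵢ` summing to `1` and an orthonormal family `eᵢ`. -/
def IsNormalState {H : Type*} [NormedAddCommGroup H] [InnerProductSpace ℂ H] [CompleteSpace H]
    (ω : (H →L[ℂ] H) →ₗ[ℂ] ℂ) : Prop :=
  ∃ (ι : Type) (_ : Countable ι) (t : ι → ℝ) (e : ι → H),
    (∀ i, 0 ≤ t i) ∧ HasSum t 1 ∧ Orthonormal ℂ e ∧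
    ∀ A : H →L[ℂ] H, HasSum (fun i => (t i : ℂ) * ⟪e i, A (e i)⟫) (ω A)

universe u

open InnerProductSpace Filter Topology

section InnerProduct

variable {H : Type*} [NormedAddCommGroup H] [InnerProductSpace ℂ H]

/-- An orthonormal family in a separable space is countable. -/
lemma Orthonormal.countable_of_separableSpace [TopologicalSpace.SeparableSpace H]
    {ι : Type*} {e : ι → H} (he : Orthonormal ℂ e) : Countable ι := by
  refine Pairwise.countable_of_isOpen_disjoint (s := fun i => Metric.ball (e i) (1 / 2)) ?_
    (fun _ => Metric.isOpen_ball) (fun i => ⟨e i, Metric.mem_ball_self (by norm_num)⟩)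
  intro i j hij
  refine Metric.ball_disjoint_ball ?_
  have h : ‖e i - e j‖ ^ 2 = 2 := by
    rw [@norm_sub_sq ℂ, he.1 i, he.1 j, he.2 hij]
    norm_num
  rw [dist_eq_norm]
  nlinarith [norm_nonneg (e i - e j)]

/-- The sum of finitely many diagonal rank-one operators is compact. -/
lemma isCompactOperator_sum_rankOne {ι : Type*} (e : ι → H) (F : Finset ι) :
    IsCompactOperator (∑ i ∈ F, rankOne ℂ (e i) (e i) : H →L[ℂ] H) := by
  classical
  induction F using Finset.induction_on with
  | empty => simpa using isCompactOperator_zero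
  | insert i F hi ih =>
    rw [Finset.sum_insert hi]
    refine IsCompactOperator.add ?_ ih
    rw [rankOne_def']
    exact (isCompactOperator_of_locallyCompactSpace_rng
      (ContinuousLinearMap.toSpanSingleton ℂ (e i))).comp_clm (innerSL ℂ (e i))

lemma tendsto_sqrt_re_apply_one_sub_sum_rankOne {f : (H →L[ℂ] H) →ₚ[ℂ] ℂ} {ι : Type*} {e : ι → H}
    (he : HasSum (fun i => f (rankOne ℂ (e i) (e i))) (f 1)) :
    Tendsto (fun F : Finset ι => √(f (1 - ∑ i ∈ F, rankOne ℂ (e i) (e i))).re) atTop (𝓝 0) := by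
  have h : Tendsto (fun F : Finset ι => f 1 - ∑ i ∈ F, f (rankOne ℂ (e i) (e i))) atTop
      (𝓝 (f 1 - f 1)) := tendsto_const_nhds.sub he
  have h2 := (Real.continuous_sqrt.comp Complex.continuous_re).continuousAt.tendsto.comp h
  simpa [Function.comp_def, map_sub, map_sum] using h2

end InnerProduct

section HilbertSpace

variable {H : Type*} [NormedAddCommGroup H] [InnerProductSpace ℂ H] [CompleteSpace H]

/-- The orthogonal projection onto the closed span of the vectors `e i` with `i ∈ X`. -/
noncomputable def spanProjection {ι : Type*} (e : ι → H) (X : Set ι) : H →L[ℂ] H :=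
  (Submodule.span ℂ (e '' X)).topologicalClosure.starProjection

lemma isStarProjection_spanProjection {ι : Type*} (e : ι → H) (X : Set ι) :
    IsStarProjection (spanProjection e X) :=
  isStarProjection_starProjection

lemma spanProjection_apply_of_mem {ι : Type*} (e : ι → H) {X : Set ι} {i : ι} (hi : i ∈ X) :
    spanProjection e X (e i) = e i :=
  Submodule.starProjection_eq_self_iff.2
    (Submodule.le_topologicalClosure _ (Submodule.subset_span (Set.mem_image_of_mem e hi)))

lemma spanProjection_apply_of_notMem {ι : Type*} {e : ι → H} (he : Orthonormal ℂ e)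
    {X : Set ι} {i : ι} (hi : i ∉ X) : spanProjection e X (e i) = 0 := by
  rw [spanProjection, Submodule.starProjection_apply_eq_zero_iff,
    Submodule.orthogonal_closure]
  rw [Submodule.mem_orthogonal]
  intro u hu
  induction hu using Submodule.span_induction with
  | mem x hx =>
    obtain ⟨j, hj, rfl⟩ := hx
    exact he.2 (fun h => hi (h ▸ hj))
  | zero => simp
  | add x y _ _ hx hy => rw [inner_add_left, hx, hy, add_zero]
  | smul a x _ hx => rw [inner_smul_left, hx, mul_zero]

lemma HilbertBasis.hasSum_inner_spanProjection {ι : Type*} (e : HilbertBasis ι ℂ H) (X : Set ι)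
    (φ ψ : H) :
    HasSum (X.indicator fun i => ⟪φ, e i⟫ * ⟪e i, ψ⟫) ⟪φ, spanProjection e X ψ⟫ := by
  have h := e.hasSum_inner_mul_inner φ (spanProjection e X ψ)
  suffices hfun : (X.indicator fun i => ⟪φ, e i⟫ * ⟪e i, ψ⟫) =
      fun i => ⟪φ, e i⟫ * ⟪e i, spanProjection e X ψ⟫ by rwa [hfun]
  funext i
  have hsa : ⟪e i, spanProjection e X ψ⟫ = ⟪spanProjection e X (e i), ψ⟫ :=
    (Submodule.inner_starProjection_left_eq_right _ _ _).symm
  rw [hsa]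
  by_cases hi : i ∈ X
  · rw [Set.indicator_of_mem hi, spanProjection_apply_of_mem e hi]
  · rw [Set.indicator_of_notMem hi, spanProjection_apply_of_notMem e.orthonormal hi]
    simp

lemma HilbertBasis.spanProjection_univ {ι : Type*} (e : HilbertBasis ι ℂ H) :
    spanProjection e Set.univ = 1 := by
  ext ψ
  refine ext_inner_left ℂ fun φ => ?_
  have h := e.hasSum_inner_spanProjection Set.univ φ ψ
  rw [Set.indicator_univ] at h
  exact h.unique (e.hasSum_inner_mul_inner φ ψ)

lemma HilbertBasis.spanProjection_singleton {ι : Type*} (e : HilbertBasis ι ℂ H) (i : ι) :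
    spanProjection e {i} = rankOne ℂ (e i) (e i) := by
  ext ψ
  refine ext_inner_left ℂ fun φ => ?_
  have h : HasSum (({i} : Set ι).indicator fun i => ⟪φ, e i⟫ * ⟪e i, ψ⟫)
      (({i} : Set ι).indicator (fun i => ⟪φ, e i⟫ * ⟪e i, ψ⟫) i) :=
    hasSum_single i fun j hj => Set.indicator_of_notMem (s := {i}) hj _
  rw [(e.hasSum_inner_spanProjection {i} φ ψ).unique h,
    Set.indicator_of_mem (Set.mem_singleton i), rankOne_apply, inner_smul_right, mul_comm]

lemma spanProjection_empty {ι : Type*} (e : ι → H) : spanProjection e ∅ = 0 := by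
  ext x
  simp [spanProjection]

/-- The projection-valued measure on `ℕ` given by a Hilbert basis with indices labelled in `ℕ`. -/
lemma HilbertBasis.isPOVM_spanProjection {ι : Type*} (e : HilbertBasis ι ℂ H) (c : ι → ℕ) :
    IsPOVM fun X : Set ℕ => spanProjection e (c ⁻¹' X) := by
  refine ⟨fun X _ => .of_isStarProjection (isStarProjection_spanProjection _ _), ?_, ?_⟩
  · exact e.spanProjection_univ
  · intro φ X _ hX
    have hd : Pairwise (Function.onFun Disjoint fun n => c ⁻¹' X n) :=
      fun m n hmn => (hX hmn).preimage c
    have h := e.hasSum_inner_spanProjection (c ⁻¹' ⋃ n, X n) φ φ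
    rw [Set.preimage_iUnion, ← hasSum_subtype_iff_indicator,
      ← (Set.unionEqSigmaOfDisjoint hd).symm.hasSum_iff] at h
    change HasSum (fun n => ⟪φ, spanProjection e (c ⁻¹' X n) φ⟫)
      ⟪φ, spanProjection e (c ⁻¹' ⋃ n, X n) φ⟫
    rw [Set.preimage_iUnion]
    refine h.sigma fun n => ?_
    have hn := e.hasSum_inner_spanProjection (c ⁻¹' X n) φ φ
    rw [← hasSum_subtype_iff_indicator] at hn
    exact hn

/-- The projection onto the span of finitely many members of an orthonormal family. -/
lemma Orthonormal.isStarProjection_sum_rankOne {ι : Type*} {e : ι → H} (he : Orthonormal ℂ e)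
    (F : Finset ι) : IsStarProjection (∑ i ∈ F, rankOne ℂ (e i) (e i)) := by
  classical
  constructor
  · rw [IsIdempotentElem, Finset.sum_mul_sum]
    refine Finset.sum_congr rfl fun i hi => ?_
    simp only [ContinuousLinearMap.mul_def, rankOne_comp_rankOne, orthonormal_iff_ite.1 he]
    simp [hi]
  · refine isSelfAdjoint_sum _ fun i _ => ?_
    rw [ContinuousLinearMap.isSelfAdjoint_iff', adjoint_rankOne]

/-- A compact symmetric operator on a Hilbert space admits a Hilbert basis of eigenvectors. -/
lemma IsCompactOperator.exists_hilbertBasis_eigenvectors {H : Type u} [NormedAddCommGroup H]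
    [InnerProductSpace ℂ H] [CompleteSpace H] {T : H →L[ℂ] H}
    (hT : IsCompactOperator T) (hsymm : (T : H →ₗ[ℂ] H).IsSymmetric) :
    ∃ (ι : Type u) (e : HilbertBasis ι ℂ H) (μ : ι → ℂ), ∀ i, T (e i) = μ i • e i := by
  let V : ℂ → Submodule ℂ H := fun μ => Module.End.eigenspace (T : Module.End ℂ H) μ
  have hV (μ : ℂ) : CompleteSpace (V μ) := by
    refine IsClosed.completeSpace_coe (hs := ?_)
    have : (V μ : Set H) = {x | T x = μ • x} := by
      ext x
      exact Module.End.mem_eigenspace_iff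
    rw [this]
    exact isClosed_eq T.continuous (continuous_const_smul μ)
  choose w b hb using fun μ => exists_hilbertBasis ℂ (V μ)
  have hon : Orthonormal ℂ fun a : Σ μ, w μ => ((b a.1 a.2 : V a.1) : H) :=
    hsymm.orthogonalFamily_eigenspaces.orthonormal_sigma_orthonormal fun μ => (b μ).orthonormal
  refine ⟨_, HilbertBasis.mkOfOrthogonalEqBot hon ?_, fun a => a.1, fun a => ?_⟩
  · rw [eq_bot_iff, ← ContinuousLinearMap.orthogonalComplement_iSup_eigenspaces_eq_bot hT hsymm]
    rw [← Submodule.iInf_orthogonal]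
    refine le_iInf fun μ u hu => ?_
    rw [Submodule.mem_orthogonal']
    intro x hx
    have hsum := ((b μ).hasSum_repr ⟨x, hx⟩).mapL (innerSL ℂ u ∘L (V μ).subtypeL)
    refine hsum.unique ?_
    have hi (i : w μ) : ⟪u, ((b μ i : V μ) : H)⟫ = 0 :=
      Submodule.inner_left_of_mem_orthogonal
        (Submodule.subset_span (Set.mem_range_self (⟨μ, i⟩ : Σ μ, w μ))) hu
    simp [hi, hasSum_zero]
  · rw [HilbertBasis.coe_mkOfOrthogonalEqBot]
    exact Module.End.mem_eigenspace_iff.1 (b a.1 a.2).2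

end HilbertSpace

section PositiveFunctional

variable {H : Type u} [NormedAddCommGroup H] [InnerProductSpace ℂ H] [CompleteSpace H]
  (f : (H →L[ℂ] H) →ₚ[ℂ] ℂ)

/-- A Cauchy–Schwarz estimate: a positive functional is small on `P * A` when it is small on the
projection `P`. -/
lemma PositiveLinearMap.exists_norm_apply_mul_le_of_isStarProjection :
    ∃ C : ℝ, ∀ P A : H →L[ℂ] H, IsStarProjection P →
      ‖f (P * A)‖ ≤ √(f P).re * (C * ‖A‖) := by
  obtain ⟨C, hC⟩ := f.exists_norm_apply_le
  refine ⟨√C, fun P A hP => ?_⟩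
  have h := norm_inner_le_norm (𝕜 := ℂ) (f.toPreGNS P) (f.toPreGNS A)
  rw [f.preGNS_inner_def, f.preGNS_norm_def, f.preGNS_norm_def] at h
  simp only [f.ofPreGNS_toPreGNS, hP.isSelfAdjoint.star_eq, hP.isIdempotentElem.eq] at h
  refine h.trans (mul_le_mul_of_nonneg_left ?_ (Real.sqrt_nonneg _))
  rw [← Real.sqrt_sq (norm_nonneg A), ← Real.sqrt_mul C.coe_nonneg]
  refine Real.sqrt_le_sqrt ((Complex.re_le_norm _).trans ((hC _).trans_eq ?_))
  rw [CStarRing.norm_star_mul_self, pow_two]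

variable {f}

/-- A positive functional that is additive along a Hilbert basis is determined by the operators
`|e i⟩⟨e i| A`. -/
lemma hasSum_apply_rankOne_mul {ι : Type*} {e : HilbertBasis ι ℂ H}
    (he : HasSum (fun i => f (rankOne ℂ (e i) (e i))) (f 1)) (A : H →L[ℂ] H) :
    HasSum (fun i => f (rankOne ℂ (e i) (e i) * A)) (f A) := by
  obtain ⟨C, hC⟩ := f.exists_norm_apply_mul_le_of_isStarProjection
  rw [HasSum, SummationFilter.unconditional_filter, tendsto_iff_norm_sub_tendsto_zero]
  have h := (tendsto_sqrt_re_apply_one_sub_sum_rankOne he).mul_const (C * ‖A‖)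
  rw [zero_mul] at h
  refine squeeze_zero (fun _ => norm_nonneg _) (fun F => ?_) h
  refine le_trans (le_of_eq ?_)
    (hC _ A (e.orthonormal.isStarProjection_sum_rankOne F).one_sub)
  rw [norm_sub_rev, sub_mul, one_mul, map_sub, Finset.sum_mul, map_sum]

variable (f)

/-- The operator `ρ` with `⟪ρ v, w⟫ = f(|w⟩⟨v|)`. -/
noncomputable def densityOperator : H →L[ℂ] H :=
  continuousLinearMapOfBilin
    ((ContinuousLinearMap.compL ℂ H (H →L[ℂ] H) ℂ
      ⟨(f : (H →L[ℂ] H) →ₗ[ℂ] ℂ), map_continuous f⟩).comp (rankOne ℂ : H →L[ℂ] _).flip)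

lemma inner_densityOperator_left (v w : H) :
    ⟪densityOperator f v, w⟫ = f (rankOne ℂ w v) := by
  simp only [densityOperator, continuousLinearMapOfBilin_apply]
  rfl

lemma isSymmetric_densityOperator : (densityOperator f : H →ₗ[ℂ] H).IsSymmetric := by
  intro v w
  change ⟪densityOperator f v, w⟫ = ⟪v, densityOperator f w⟫
  rw [← inner_conj_symm v, inner_densityOperator_left, inner_densityOperator_left,
    ← Complex.star_def, ← map_star, ContinuousLinearMap.star_eq_adjoint, adjoint_rankOne]

variable {f}

lemma isCompactOperator_densityOperator {ι : Type*} {e : HilbertBasis ι ℂ H}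
    (he : HasSum (fun i => f (rankOne ℂ (e i) (e i))) (f 1)) :
    IsCompactOperator (densityOperator f) := by
  obtain ⟨C, hC⟩ := f.exists_norm_apply_mul_le_of_isStarProjection
  refine isCompactOperator_of_tendsto (l := (atTop : Filter (Finset ι)))
    (F := fun F => (∑ i ∈ F, rankOne ℂ (e i) (e i)) * densityOperator f) ?_
    (.of_forall fun F => (isCompactOperator_sum_rankOne e F).comp_clm _)
  rw [tendsto_iff_norm_sub_tendsto_zero]
  have h := (tendsto_sqrt_re_apply_one_sub_sum_rankOne he).mul_const |C|
  rw [zero_mul] at h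
  refine squeeze_zero (fun _ => norm_nonneg _) (fun F => ?_) h
  rw [norm_sub_rev]
  refine ContinuousLinearMap.opNorm_le_bound _ (by positivity) fun v => ?_
  set P : H →L[ℂ] H := ∑ i ∈ F, rankOne ℂ (e i) (e i)
  have hP : IsStarProjection (1 - P) := (e.orthonormal.isStarProjection_sum_rankOne F).one_sub
  have hx : (densityOperator f - P * densityOperator f) v = (1 - P) (densityOperator f v) := rfl
  rw [hx]
  set x := (1 - P) (densityOperator f v)
  have hxx : ⟪x, x⟫ = f ((1 - P) * rankOne ℂ x v) := by
    rw [ContinuousLinearMap.mul_def, comp_rankOne, ← inner_densityOperator_left]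
    refine Eq.trans ?_ (ContinuousLinearMap.adjoint_inner_left (1 - P) x (densityOperator f v))
    rw [ContinuousLinearMap.isSelfAdjoint_iff'.1 hP.isSelfAdjoint]
  have hle := hC _ (rankOne ℂ x v) hP
  rw [← hxx, norm_rankOne, inner_self_eq_norm_sq_to_K, norm_pow, RCLike.norm_ofReal,
    abs_norm] at hle
  rcases (norm_nonneg x).eq_or_lt with h0 | h0
  · rw [← h0]
    positivity
  · refine le_of_mul_le_mul_left ?_ h0
    calc ‖x‖ * ‖x‖ = ‖x‖ ^ 2 := (pow_two _).symm
      _ ≤ √(f (1 - P)).re * (|C| * (‖x‖ * ‖v‖)) := by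
        refine hle.trans ?_
        gcongr
        exact le_abs_self C
      _ = ‖x‖ * (√(f (1 - P)).re * |C| * ‖v‖) := by ring

/-- If a positive functional is additive along every Hilbert basis, then it is diagonal in some
Hilbert basis. -/
lemma exists_hilbertBasis_hasSum
    (hf : ∀ (ι : Type u) (e : HilbertBasis ι ℂ H),
      HasSum (fun i => f (rankOne ℂ (e i) (e i))) (f 1)) :
    ∃ (ι : Type u) (e : HilbertBasis ι ℂ H) (t : ι → ℝ), (∀ i, 0 ≤ t i) ∧
      ∀ A : H →L[ℂ] H, HasSum (fun i => (t i : ℂ) * ⟪e i, A (e i)⟫) (f A) := by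
  obtain ⟨w, b, -⟩ := exists_hilbertBasis ℂ H
  obtain ⟨ι, e, μ, hμ⟩ := (isCompactOperator_densityOperator
    (hf w b)).exists_hilbertBasis_eigenvectors (isSymmetric_densityOperator f)
  have key (i : ι) (A : H →L[ℂ] H) :
      f (rankOne ℂ (e i) (e i) * A) = μ i * ⟪e i, A (e i)⟫ := by
    have hmul : rankOne ℂ (e i) (e i) * A =
        rankOne ℂ (e i) (ContinuousLinearMap.adjoint A (e i)) := by
      rw [ContinuousLinearMap.mul_def, rankOne_comp]
    have hsymm := isSymmetric_densityOperator f (ContinuousLinearMap.adjoint A (e i)) (e i)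
    rw [hmul, ← inner_densityOperator_left]
    refine hsymm.trans ?_
    rw [ContinuousLinearMap.coe_coe, hμ, inner_smul_right,
      ContinuousLinearMap.adjoint_inner_left]
  have hμ_nonneg (i : ι) : 0 ≤ μ i := by
    have h := key i 1
    rw [mul_one, one_apply_eq_self, inner_self_eq_norm_sq_to_K, e.orthonormal.1 i]
      at h
    have hp : 0 ≤ f (rankOne ℂ (e i) (e i)) :=
      f.map_nonneg ((ContinuousLinearMap.nonneg_iff_isPositive _).2 (isPositive_rankOne_self _))
    simpa [h] using hp
  refine ⟨ι, e, fun i => (μ i).re, fun i => (Complex.nonneg_iff.1 (hμ_nonneg i)).1, fun A => ?_⟩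
  have hre (i : ι) : ((μ i).re : ℂ) = μ i :=
    (Complex.eq_re_of_ofReal_le (r := 0) (by simpa only [Complex.ofReal_zero] using hμ_nonneg i)).symm
  simp only [hre, ← key]
  exact hasSum_apply_rankOne_mul (hf ι e) A

end PositiveFunctional

lemma hasSum_comm_of_nonneg {α β : Type*} {f : α → β → ℝ} {g : α → ℝ} {c : β → ℝ} {s : ℝ}
    (hf : ∀ a b, 0 ≤ f a b) (hrow : ∀ a, HasSum (f a) (g a)) (hg : HasSum g s)
    (hcol : ∀ b, HasSum (fun a => f a b) (c b)) : HasSum c s := by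
  have hsum : Summable (Function.uncurry f) := by
    refine (summable_prod_of_nonneg fun x => hf x.1 x.2).2 ⟨fun a => (hrow a).summable, ?_⟩
    simpa only [Function.uncurry_apply_pair, (hrow _).tsum_eq] using hg.summable
  have hs : HasSum (Function.uncurry f) s := by
    rw [← (hsum.hasSum.prod_fiberwise hrow).unique hg]
    exact hsum.hasSum
  exact ((Equiv.prodComm β α).hasSum_iff.2 hs).prod_fiberwise hcol

section States

variable {H : Type u} [NormedAddCommGroup H] [InnerProductSpace ℂ H] [CompleteSpace H]
  {ω : (H →L[ℂ] H) →ₗ[ℂ] ℂ}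

lemma IsNormalState.hasSum_apply_iUnion (hω : IsNormalState ω)
    (hpos : ∀ A : H →L[ℂ] H, A.IsPositive → 0 ≤ ω A)
    {Ω : Type*} [MeasurableSpace Ω] {M : Set Ω → (H →L[ℂ] H)} (hM : IsPOVM M)
    {X : ℕ → Set Ω} (hX : ∀ n, MeasurableSet (X n))
    (hd : Pairwise fun m n => Disjoint (X m) (X n)) :
    HasSum (fun n => ω (M (X n))) (ω (M (⋃ n, X n))) := by
  obtain ⟨ι, -, t, e, ht, -, -, hA⟩ := hω
  obtain ⟨hMpos, -, hMadd⟩ := hM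
  have hre (A : H →L[ℂ] H) : HasSum (fun i => t i * (⟪e i, A (e i)⟫).re) (ω A).re := by
    simpa only [Complex.re_ofReal_mul] using (Complex.hasSum_iff _ _).1 (hA A) |>.1
  have him (Y : Set Ω) (hY : MeasurableSet Y) : (ω (M Y)).im = 0 :=
    (Complex.nonneg_iff.1 (hpos _ (hMpos Y hY))).2.symm
  rw [Complex.hasSum_iff]
  constructor
  · refine hasSum_comm_of_nonneg (f := fun i n => t i * (⟪e i, M (X n) (e i)⟫).re)
      (fun i n => ?_) (fun i => ?_) (hre _) (fun n => hre _)
    · exact mul_nonneg (ht i) (Complex.nonneg_iff.1 ((hMpos _ (hX n)).inner_nonneg_right (e i))).1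
    · exact (((Complex.hasSum_iff _ _).1 (hMadd (e i) X hX hd)).1).mul_left (t i)
  · simp only [him _ (hX _), him _ (MeasurableSet.iUnion hX), hasSum_zero]

/-- Additivity of `ω` along all POVMs on `ℕ` gives additivity along all countable Hilbert bases. -/
lemma hasSum_rankOne_of_hasSum_povm
    (hω : ∀ M : Set ℕ → (H →L[ℂ] H), IsPOVM M → ∀ X : ℕ → Set ℕ, (∀ n, MeasurableSet (X n)) →
      (Pairwise fun m n => Disjoint (X m) (X n)) →
      HasSum (fun n => ω (M (X n))) (ω (M (⋃ n, X n))))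
    {ι : Type*} [Countable ι] (e : HilbertBasis ι ℂ H) :
    HasSum (fun i => ω (rankOne ℂ (e i) (e i))) (ω 1) := by
  obtain ⟨c, hc⟩ := exists_injective_nat ι
  have h := hω _ (e.isPOVM_spanProjection c) (fun n => {n}) (fun _ => .of_discrete)
    fun m n hmn => Set.disjoint_singleton.2 hmn
  simp only [Set.iUnion_of_singleton, Set.preimage_univ, e.spanProjection_univ] at h
  rw [← hc.hasSum_iff] at h
  · refine h.congr_fun fun i => ?_
    rw [Function.comp_apply, ← Set.image_singleton, Set.preimage_image_eq _ hc,
      e.spanProjection_singleton]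
  · intro n hn
    rw [Set.preimage_singleton_eq_empty.2 hn, spanProjection_empty, map_zero]

lemma isNormalState_of_hasSum_povm [TopologicalSpace.SeparableSpace H]
    (hpos : ∀ A : H →L[ℂ] H, A.IsPositive → 0 ≤ ω A) (hone : ω 1 = 1)
    (hω : ∀ M : Set ℕ → (H →L[ℂ] H), IsPOVM M → ∀ X : ℕ → Set ℕ, (∀ n, MeasurableSet (X n)) →
      (Pairwise fun m n => Disjoint (X m) (X n)) →
      HasSum (fun n => ω (M (X n))) (ω (M (⋃ n, X n)))) :
    IsNormalState ω := by
  let f : (H →L[ℂ] H) →ₚ[ℂ] ℂ := PositiveLinearMap.mk₀ ω fun A hA =>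
    hpos A ((ContinuousLinearMap.nonneg_iff_isPositive A).1 hA)
  obtain ⟨ι, e, t, ht, hA⟩ := exists_hilbertBasis_hasSum (f := f) fun ι e =>
    have := e.orthonormal.countable_of_separableSpace
    hasSum_rankOne_of_hasSum_povm hω e
  have := e.orthonormal.countable_of_separableSpace
  let s : Shrink.{0} ι ≃ ι := (equivShrink.{0} ι).symm
  refine ⟨Shrink.{0} ι, s.countable_iff.2 this, t ∘ s, e ∘ s, fun i => ht _, ?_,
    e.orthonormal.comp s s.injective, fun A => ?_⟩
  · rw [s.hasSum_iff, ← Complex.hasSum_ofReal, Complex.ofReal_one, ← hone]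
    refine (hA 1).congr_fun fun i => ?_
    rw [one_apply_eq_self, inner_self_eq_norm_sq_to_K, e.orthonormal.1 i]
    simp
  · exact s.hasSum_iff.2 (hA A)

end States

/-- A state `ω` on `B(H)` (for separable `H`) is normal if and only if for every POVM `M`
on a standard Borel space the set function `X ↦ ω(M(X))` is countably additive. -/
theorem stmt6 {H : Type*} [NormedAddCommGroup H] [InnerProductSpace ℂ H] [CompleteSpace H]
    [TopologicalSpace.SeparableSpace H]
    (ω : (H →L[ℂ] H) →ₗ[ℂ] ℂ)
    (hpos : ∀ A : H →L[ℂ] H, A.IsPositive → 0 ≤ ω A)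
    (hone : ω 1 = 1) :
    IsNormalState ω ↔
      ∀ (Ω : Type) [MeasurableSpace Ω] [StandardBorelSpace Ω],
        ∀ M : Set Ω → (H →L[ℂ] H), IsPOVM M →
          ∀ X : ℕ → Set Ω, (∀ n, MeasurableSet (X n)) →
            (Pairwise fun m n => Disjoint (X m) (X n)) →
            HasSum (fun n => ω (M (X n))) (ω (M (⋃ n, X n))) := by
  exact ⟨fun h Ω _ _ M hM X hX hd => h.hasSum_apply_iUnion hpos hM hX hd,
    fun h => isNormalState_of_hasSum_povm hpos hone (h ℕ)⟩
end

section
/- Let H be a complex Hilbert space and let W ⊆ B(H) be a complex linear subspace containing the identity 1 and closed under taking adjoints. Let B : W × W → W be a bilinear map satisfying: (1) B(A, C) ≥ 0 (as an operator) whenever A, C ∈ W are positive operators; (2) B(A, 1) = A = B(1, A) for all A ∈ W. Let Σ denote the convex set of all linear functionals φ : W → ℂ such that φ(A) ≥ 0 for every positive operator A ∈ W and φ(1) = 1. Then every extreme point φ of Σ is multiplicative with respect to B: φ(B(A, C)) = φ(A)·φ(C) for all A, C ∈ W. -/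
open scoped ComplexOrder

/-- Cutting a functional `φ` along a positive decomposition `P + Q = c • 1` with `φ P, φ Q > 0`
exhibits `φ` as a proper convex combination, so extremality makes `φ` multiplicative at `P`. -/
theorem map_bilin_of_add_eq_smul_one {H : Type*} [NormedAddCommGroup H] [InnerProductSpace ℂ H]
    [CompleteSpace H]
    (W : Submodule ℂ (H →L[ℂ] H)) (h1W : (1 : H →L[ℂ] H) ∈ W)
    (B : W →ₗ[ℂ] W →ₗ[ℂ] W)
    (hBpos : ∀ A C : W, (A : H →L[ℂ] H).IsPositive → (C : H →L[ℂ] H).IsPositive →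
      ((B A C : W) : H →L[ℂ] H).IsPositive)
    (hBunit : ∀ A : W, B A ⟨1, h1W⟩ = A ∧ B ⟨1, h1W⟩ A = A)
    (φ : W →ₗ[ℂ] ℂ)
    (hφpos : ∀ A : W, (A : H →L[ℂ] H).IsPositive → 0 ≤ φ A)
    (hφone : φ ⟨1, h1W⟩ = 1)
    (hext : ¬ ∃ (s : ℝ) (φ₁ φ₂ : W →ₗ[ℂ] ℂ),
      0 < s ∧ s < 1 ∧
      (∀ A : W, (A : H →L[ℂ] H).IsPositive → 0 ≤ φ₁ A) ∧ φ₁ ⟨1, h1W⟩ = 1 ∧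
      (∀ A : W, (A : H →L[ℂ] H).IsPositive → 0 ≤ φ₂ A) ∧ φ₂ ⟨1, h1W⟩ = 1 ∧
      φ₁ ≠ φ₂ ∧ φ = (s : ℂ) • φ₁ + ((1 - s : ℝ) : ℂ) • φ₂)
    {P Q : W} (hP : (P : H →L[ℂ] H).IsPositive) (hQ : (Q : H →L[ℂ] H).IsPositive) {c : ℂ}
    (hPQ : P + Q = c • ⟨1, h1W⟩) (hφP : 0 < φ P) (hφQ : 0 < φ Q) (C : W) :
    φ (B P C) = φ P * φ C := by
  obtain ⟨p, hp, hpP⟩ : ∃ p : ℝ, 0 < p ∧ φ P = p := by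
    obtain ⟨h1, h2⟩ := Complex.lt_def.1 hφP
    exact ⟨(φ P).re, h1, Complex.ext rfl (by simpa using h2.symm)⟩
  obtain ⟨q, hq, hqQ⟩ : ∃ q : ℝ, 0 < q ∧ φ Q = q := by
    obtain ⟨h1, h2⟩ := Complex.lt_def.1 hφQ
    exact ⟨(φ Q).re, h1, Complex.ext rfl (by simpa using h2.symm)⟩
  have hp' : (p : ℂ) ≠ 0 := by exact_mod_cast hp.ne'
  have hq' : (q : ℂ) ≠ 0 := by exact_mod_cast hq.ne'
  have hpq : (p : ℂ) + q ≠ 0 := by exact_mod_cast (add_pos hp hq).ne'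
  have hc : (p : ℂ) + q = c := by
    rw [← hpP, ← hqQ, ← map_add, hPQ, map_smul, hφone, smul_eq_mul, mul_one]
  have hsum (D : W) : φ (B P D) + φ (B Q D) = (p + q) * φ D := by
    rw [← map_add, ← LinearMap.add_apply, ← map_add, hPQ, map_smul, LinearMap.smul_apply,
      (hBunit D).2, map_smul, smul_eq_mul, hc]
  have hone : φ (B P ⟨1, h1W⟩) = p ∧ φ (B Q ⟨1, h1W⟩) = q := by
    rw [(hBunit P).1, (hBunit Q).1]
    exact ⟨hpP, hqQ⟩
  have hinv {t : ℝ} (ht : 0 < t) : (0 : ℂ) ≤ (t : ℂ)⁻¹ := by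
    rw [← Complex.ofReal_inv]
    exact_mod_cast (inv_pos.2 ht).le
  by_cases hne : (p : ℂ)⁻¹ • (φ ∘ₗ B P) = (q : ℂ)⁻¹ • (φ ∘ₗ B Q)
  · have h := LinearMap.congr_fun hne C
    simp only [LinearMap.smul_apply, LinearMap.comp_apply, smul_eq_mul] at h
    have h2 := hsum C
    rw [hpP]
    field_simp at h
    refine mul_left_cancel₀ hpq ?_
    linear_combination h + p * h2
  · refine absurd ⟨p / (p + q), (p : ℂ)⁻¹ • (φ ∘ₗ B P), (q : ℂ)⁻¹ • (φ ∘ₗ B Q),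
      by positivity, by rw [div_lt_one (by positivity)]; linarith,
      fun A hA => mul_nonneg (hinv hp) (hφpos _ (hBpos _ _ hP hA)), ?_,
      fun A hA => mul_nonneg (hinv hq) (hφpos _ (hBpos _ _ hQ hA)), ?_, hne, ?_⟩ hext
    · simp [hone.1, hp']
    · simp [hone.2, hq']
    · ext D
      have h2 := hsum D
      simp only [LinearMap.add_apply, LinearMap.smul_apply, LinearMap.comp_apply, smul_eq_mul]
      push_cast
      field_simp
      linear_combination -q * h2

/-- Let `W ⊆ B(H)` be a unital, adjoint-closed subspace and `B : W × W → W` a bilinear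
map that is bipositive and has `1` as a two-sided unit.  Then every extreme point of the
convex set `Σ` of positive normalized linear functionals on `W` is multiplicative with
respect to `B`. -/
theorem stmt12 {H : Type*} [NormedAddCommGroup H] [InnerProductSpace ℂ H] [CompleteSpace H]
    (W : Submodule ℂ (H →L[ℂ] H)) (h1W : (1 : H →L[ℂ] H) ∈ W)
    (hWadj : ∀ A ∈ W, ContinuousLinearMap.adjoint A ∈ W)
    (B : W →ₗ[ℂ] W →ₗ[ℂ] W)
    (hBpos : ∀ A C : W, (A : H →L[ℂ] H).IsPositive → (C : H →L[ℂ] H).IsPositive →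
      ((B A C : W) : H →L[ℂ] H).IsPositive)
    (hBunit : ∀ A : W, B A ⟨1, h1W⟩ = A ∧ B ⟨1, h1W⟩ A = A)
    (φ : W →ₗ[ℂ] ℂ)
    (hφpos : ∀ A : W, (A : H →L[ℂ] H).IsPositive → 0 ≤ φ A)
    (hφone : φ ⟨1, h1W⟩ = 1)
    (hext : ¬ ∃ (s : ℝ) (φ₁ φ₂ : W →ₗ[ℂ] ℂ),
      0 < s ∧ s < 1 ∧
      (∀ A : W, (A : H →L[ℂ] H).IsPositive → 0 ≤ φ₁ A) ∧ φ₁ ⟨1, h1W⟩ = 1 ∧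
      (∀ A : W, (A : H →L[ℂ] H).IsPositive → 0 ≤ φ₂ A) ∧ φ₂ ⟨1, h1W⟩ = 1 ∧
      φ₁ ≠ φ₂ ∧ φ = (s : ℂ) • φ₁ + ((1 - s : ℝ) : ℂ) • φ₂) :
    ∀ A C : W, φ (B A C) = φ A * φ C := by
  have key (A : W) (hA : IsSelfAdjoint (A : H →L[ℂ] H)) (C : W) : φ (B A C) = φ A * φ C := by
    set n : ℝ := ‖(A : H →L[ℂ] H)‖
    have hone : (1 : H →L[ℂ] H).IsPositive := ContinuousLinearMap.isPositive_one
    have hadd : ((n : ℂ) • (1 : H →L[ℂ] H) + A).IsPositive := by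
      have h := (ContinuousLinearMap.le_def _ _).1 hA.neg_algebraMap_norm_le_self
      rwa [Algebra.algebraMap_eq_smul_one, sub_neg_eq_add, add_comm, ← Complex.coe_smul] at h
    have hsub : ((n : ℂ) • (1 : H →L[ℂ] H) - A).IsPositive := by
      have h := (ContinuousLinearMap.le_def _ _).1 hA.le_algebraMap_norm_self
      rwa [Algebra.algebraMap_eq_smul_one, ← Complex.coe_smul] at h
    let e : W := ⟨1, h1W⟩
    have hφadd : 0 ≤ φ ((n : ℂ) • e + A) := hφpos _ hadd
    have hφsub : 0 ≤ φ ((n : ℂ) • e - A) := hφpos _ hsub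
    have h := map_bilin_of_add_eq_smul_one W h1W B hBpos hBunit φ hφpos hφone hext
      (P := ((n : ℂ) • e + A) + e) (Q := ((n : ℂ) • e - A) + e) (c := 2 * n + 2)
      (hadd.add hone) (hsub.add hone) (by module)
      (by rw [map_add, hφone]; exact add_pos_of_nonneg_of_pos hφadd one_pos)
      (by rw [map_add, hφone]; exact add_pos_of_nonneg_of_pos hφsub one_pos) C
    simp only [map_add, map_smul, LinearMap.add_apply, LinearMap.smul_apply, smul_eq_mul] at h
    rw [show B e C = C from (hBunit C).2, show φ e = 1 from hφone] at h
    linear_combination h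
  intro A C
  let A' : W := ⟨ContinuousLinearMap.adjoint (A : H →L[ℂ] H), hWadj A A.2⟩
  have hre : IsSelfAdjoint ((A + A' : W) : H →L[ℂ] H) :=
    IsSelfAdjoint.add_star_self (A : H →L[ℂ] H)
  have him : IsSelfAdjoint ((Complex.I • (A - A') : W) : H →L[ℂ] H) := by
    change star (Complex.I • ((A : H →L[ℂ] H) - star (A : H →L[ℂ] H))) =
      Complex.I • ((A : H →L[ℂ] H) - star (A : H →L[ℂ] H))
    rw [star_smul, star_sub, star_star, Complex.star_def, Complex.conj_I, neg_smul, ← smul_neg,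
      neg_sub]
  have h1 := key _ hre C
  have h2 := key _ him C
  simp only [map_add, map_sub, map_smul, LinearMap.add_apply, LinearMap.sub_apply,
    LinearMap.smul_apply, smul_eq_mul] at h1 h2
  have h3 := mul_left_cancel₀ Complex.I_ne_zero (h2.trans (mul_assoc _ _ _))
  linear_combination (h1 + h3) / 2
end
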